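/- Fix k ≥ 1. For a word w = (w_1, …, w_k) ∈ ℤ^k, let Φ(w) denote the bijection of ℤ given by Φ(w) = W_{(w_k,w_k+1)} ∘ ⋯ ∘ W_{(w_1,w_1+1)} (id), where id is the identity bijection of ℤ and W_{(w_1,w_1+1)} is applied first. Let μ be a probability measure on ℤ^k that is invariant under the reversal map (w_1, …, w_k) ↦ (w_k, …, w_1) (for example, any i.i.d. product measure). Then the pushforward of μ under Φ equals the pushforward of μ under w ↦ (Φ(w))⁻¹; in other words, the random permutation Φ(W) of ℤ, where W has law μ, has the same distribution as its inverse (Φ(W))⁻¹. -/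

import Mathlib

open MeasureTheory

/-- The totally asymmetric swap operator `W_{(z,z+1)}` acting on bijections of `ℤ`:
it exchanges the values at positions `z` and `z+1` (i.e. precomposes with the
transposition of `z` and `z+1`) if the value at `z` is smaller than the value at
`z+1`, and does nothing otherwise. -/
noncomputable def W (z : ℤ) (η : Equiv.Perm ℤ) : Equiv.Perm ℤ :=
  if η z < η (z + 1) then (Equiv.swap z (z + 1)).trans η else η

/-- Applying the word `[z_1, …, z_k]` of swap operators to a bijection, the
leftmost letter `z_1` acting first: `W_{(z_k,z_k+1)} ∘ ⋯ ∘ W_{(z_1,z_1+1)}`. -/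
noncomputable def applyWord (l : List ℤ) (η : Equiv.Perm ℤ) : Equiv.Perm ℤ :=
  l.foldl (fun η z => W z η) η

/-- The map `Φ` sending a word `w = (w_1, …, w_k) ∈ ℤ^k` to the bijection
`W_{(w_k,w_k+1)} ∘ ⋯ ∘ W_{(w_1,w_1+1)} (id)` of `ℤ` (with `w_1` applied first). -/
noncomputable def Phi {k : ℕ} (w : Fin k → ℤ) : Equiv.Perm ℤ :=
  applyWord (List.ofFn w) 1

/-- The set of bijections of `ℤ` carries the full power-set σ-algebra. -/
instance : MeasurableSpace (Equiv.Perm ℤ) := ⊤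

theorem swap_lt_aux (b x y : ℤ) (h1 : ¬ (x = b ∧ y = b + 1)) (h2 : ¬ (x = b + 1 ∧ y = b)) :
    (Equiv.swap b (b + 1) x < Equiv.swap b (b + 1) y ↔ x < y) := by
  simp only [Equiv.swap_apply_def]
  split_ifs <;> omega

theorem W_eq (z : ℤ) (η : Equiv.Perm ℤ) :
    W z η = if η z < η (z + 1) then η * Equiv.swap z (z + 1) else η := rfl

theorem V_eq (z : ℤ) (η : Equiv.Perm ℤ) :
    (W z η⁻¹)⁻¹ = if η⁻¹ z < η⁻¹ (z + 1) then Equiv.swap z (z + 1) * η else η := by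
  rw [W_eq]
  split_ifs <;> simp

theorem W_V_comm (a b : ℤ) (η : Equiv.Perm ℤ) :
    W a (W b η⁻¹)⁻¹ = (W b (W a η)⁻¹)⁻¹ := by
  rw [V_eq b η, V_eq b (W a η), W_eq a η, W_eq]
  by_cases h1 : η a = b ∧ η (a + 1) = b + 1
  · obtain ⟨h1, h2⟩ := h1
    have h3 : η⁻¹ b = a := by rw [← h1]; simp
    have h4 : η⁻¹ (b + 1) = a + 1 := by rw [← h2]; simp
    have h5 : Equiv.swap b (b + 1) * η = η * Equiv.swap a (a + 1) := by
      rw [Equiv.mul_swap_eq_swap_mul, h1, h2]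
    have h6 : (Equiv.symm η) b = a := h3
    have h7 : (Equiv.symm η) (b + 1) = a + 1 := h4
    simp [h1, h2, h3, h4, h5, h6, h7]
  by_cases h2 : η a = b + 1 ∧ η (a + 1) = b
  · obtain ⟨h1, h2⟩ := h2
    have h3 : η⁻¹ b = a + 1 := by rw [← h2]; simp
    have h4 : η⁻¹ (b + 1) = a := by rw [← h1]; simp
    simp [h1, h2, h3, h4]
  have k1 := swap_lt_aux b (η a) (η (a + 1)) h1 h2
  have k2 := swap_lt_aux a (η⁻¹ b) (η⁻¹ (b + 1))
    (by rintro ⟨e1, e2⟩; exact h1 ⟨by rw [← e1]; simp, by rw [← e2]; simp⟩)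
    (by rintro ⟨e1, e2⟩; exact h2 ⟨by rw [← e2]; simp, by rw [← e1]; simp⟩)
  by_cases c1 : η a < η (a + 1) <;> by_cases c2 : η⁻¹ b < η⁻¹ (b + 1) <;>
    simp only [c1, c2, if_true, if_false, Equiv.Perm.mul_apply, mul_inv_rev, Equiv.swap_inv,
      k1, k2, mul_assoc]

theorem applyWord_V (b : ℤ) (l : List ℤ) (η : Equiv.Perm ℤ) :
    applyWord l (W b η⁻¹)⁻¹ = (W b (applyWord l η)⁻¹)⁻¹ := by
  induction l generalizing η with
  | nil => rfl
  | cons a l ih =>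
    change applyWord l (W a (W b η⁻¹)⁻¹) = (W b (applyWord l (W a η))⁻¹)⁻¹
    rw [W_V_comm, ih]

theorem applyWord_reverse (l : List ℤ) :
    applyWord l.reverse 1 = (applyWord l 1)⁻¹ := by
  induction l with
  | nil => simp [applyWord]
  | cons a l ih =>
    have h0 : W a 1 = (W a (1 : Equiv.Perm ℤ)⁻¹)⁻¹ := by
      rw [V_eq, W_eq]; simp
    have h : applyWord (a :: l) 1 = applyWord l (W a 1) := rfl
    rw [h, h0, applyWord_V, inv_inv, ← ih]
    simp [applyWord]

theorem Phi_rev {k : ℕ} (w : Fin k → ℤ) : Phi (fun i => w i.rev) = (Phi w)⁻¹ := by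
  unfold Phi
  rw [← applyWord_reverse]
  congr 1
  apply List.ext_getElem
  · simp
  · intro i h1 h2
    simp only [List.getElem_ofFn, List.getElem_reverse, List.length_ofFn]
    congr 1
    ext
    simp [Fin.rev]
    omega

/-- If `μ` is a probability measure on `ℤ^k` (with the discrete σ-algebra) that is
invariant under the reversal map `(w_1, …, w_k) ↦ (w_k, …, w_1)`, then the pushforward
of `μ` under `Φ` equals the pushforward of `μ` under `w ↦ (Φ(w))⁻¹`: the random
permutation `Φ(W)`, `W ∼ μ`, has the same distribution as its inverse. -/
theorem distributional_color_position_symmetry (k : ℕ) (hk : 1 ≤ k)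
    (μ : Measure (Fin k → ℤ)) [IsProbabilityMeasure μ]
    (hrev : μ.map (fun w : Fin k → ℤ => fun i => w i.rev) = μ) :
    μ.map (fun w => Phi w) = μ.map (fun w => (Phi w)⁻¹) := by
  have h : (fun w : Fin k → ℤ => (Phi w)⁻¹) = (fun w => Phi w) ∘ (fun w i => w i.rev) := by
    funext w
    exact (Phi_rev w).symm
  rw [h, ← Measure.map_map Measurable.of_discrete Measurable.of_discrete, hrev]
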